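/- arXiv:1004.4872 — 3 statements merged into one kernel-verified Lean document; each statement's English description precedes it below -/
import Mathlib

section
/- For every prime q with q ≡ 3 (mod 4) there exists a Hadamard matrix of order q + 1, and for every prime q with q ≡ 1 (mod 4) there exists a Hadamard matrix of order 2(q + 1). -/
/-- A Hadamard matrix of order `n`: an `n × n` real matrix with entries in `{-1, +1}`
satisfying `H * Hᵀ = n • I`. -/
def IsHadamardMatrix {n : ℕ} (H : Matrix (Fin n) (Fin n) ℝ) : Prop :=
  (∀ i j, H i j = 1 ∨ H i j = -1) ∧ H * H.transpose = (n : ℝ) • 1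

/-- There exists a Hadamard matrix of order `n`. -/
def HadamardOrder (n : ℕ) : Prop :=
  ∃ H : Matrix (Fin n) (Fin n) ℝ, IsHadamardMatrix H

open Finset Matrix

/-- A matrix with `±1` entries and pairwise orthogonal rows, indexed by any type with `n` elements,
gives a Hadamard matrix of order `n`. -/
theorem HadamardOrder.of_fintype {ι : Type*} [Fintype ι] [DecidableEq ι] {n : ℕ}
    (hn : Fintype.card ι = n) (H : Matrix ι ι ℝ) (h_entry : ∀ i j, H i j = 1 ∨ H i j = -1)
    (h_mul : H * Hᵀ = (n : ℝ) • 1) : HadamardOrder n := by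
  let e := Fintype.equivFinOfCardEq hn
  refine ⟨H.submatrix e.symm e.symm, fun i j => h_entry _ _, ?_⟩
  rw [transpose_submatrix, submatrix_mul_equiv, h_mul]
  ext i j
  simp [Matrix.one_apply]

/-- A conference matrix: zero diagonal, `±1` entries off the diagonal, and orthogonal rows. -/
structure IsConferenceMatrix {ι : Type*} [Fintype ι] [DecidableEq ι] (C : Matrix ι ι ℝ) :
    Prop where
  diag (i : ι) : C i i = 0
  off_diag (i j : ι) : i ≠ j → C i j = 1 ∨ C i j = -1
  mul_transpose : C * Cᵀ = ((Fintype.card ι : ℝ) - 1) • 1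

namespace IsConferenceMatrix

variable {ι : Type*} [Fintype ι] [DecidableEq ι] {C : Matrix ι ι ℝ}

theorem add_one_entry (hC : IsConferenceMatrix C) (i j : ι) :
    (C + 1) i j = 1 ∨ (C + 1) i j = -1 := by
  by_cases h : i = j
  · subst h; simp [hC.diag]
  · simpa [Matrix.one_apply_ne h] using hC.off_diag i j h

theorem sub_one_entry (hC : IsConferenceMatrix C) (i j : ι) :
    (C - 1) i j = 1 ∨ (C - 1) i j = -1 := by
  by_cases h : i = j
  · subst h; simp [hC.diag]
  · simpa [Matrix.one_apply_ne h] using hC.off_diag i j h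

theorem hadamardOrder_of_skew (hC : IsConferenceMatrix C) (h_skew : Cᵀ = -C) :
    HadamardOrder (Fintype.card ι) := by
  refine .of_fintype rfl (C + 1) hC.add_one_entry ?_
  have h := hC.mul_transpose
  rw [h_skew] at h
  rw [transpose_add, h_skew, transpose_one, add_mul, mul_add, h, sub_smul]
  simp

theorem hadamardOrder_of_symm (hC : IsConferenceMatrix C) (h_symm : Cᵀ = C) :
    HadamardOrder (2 * Fintype.card ι) := by
  refine .of_fintype (ι := ι ⊕ ι) (by simp [two_mul])
    (fromBlocks (C + 1) (C - 1) (C - 1) (-(C + 1))) ?_ ?_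
  · rintro (i | i) (j | j)
    · exact hC.add_one_entry i j
    · exact hC.sub_one_entry i j
    · exact hC.sub_one_entry i j
    · rw [fromBlocks_apply₂₂, neg_apply, neg_eq_iff_eq_neg, neg_inj]
      exact (hC.add_one_entry i j).symm
  · have h := hC.mul_transpose
    rw [h_symm] at h
    have h_sum : (C + 1) * (C + 1) + (C - 1) * (C - 1)
        = ((2 * Fintype.card ι : ℕ) : ℝ) • (1 : Matrix ι ι ℝ) := by
      calc (C + 1) * (C + 1) + (C - 1) * (C - 1) = (2 : ℝ) • (C * C) + (2 : ℝ) • 1 := by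
            rw [two_smul, two_smul]; noncomm_ring
        _ = _ := by
            rw [h, smul_smul, ← add_smul]; push_cast; ring_nf
    have h_comm : (C + 1) * (C - 1) = (C - 1) * (C + 1) := by noncomm_ring
    rw [fromBlocks_transpose, fromBlocks_multiply, ← fromBlocks_one, fromBlocks_smul]
    simp only [transpose_add, transpose_sub, transpose_neg, transpose_one, h_symm, mul_neg,
      neg_mul, neg_neg, smul_zero]
    rw [h_sum, add_comm ((C - 1) * (C - 1)), h_sum, h_comm, add_neg_cancel]

end IsConferenceMatrix

section Paley

variable {F : Type*} [Field F] [Fintype F] [DecidableEq F]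

theorem sum_quadraticChar_sub (hF : ringChar F ≠ 2) (a : F) :
    ∑ x, quadraticChar F (a - x) = 0 := by
  rw [← quadraticChar_sum_zero hF]
  exact (Equiv.subLeft a).sum_comp (quadraticChar F)

theorem sum_quadraticChar_sub_mul_self (a : F) :
    ∑ x, quadraticChar F (a - x) * quadraticChar F (a - x) = Fintype.card F - 1 := by
  have h_shift := (Equiv.subLeft a).sum_comp fun x => quadraticChar F x * quadraticChar F x
  simp only [Equiv.subLeft_apply] at h_shift
  rw [h_shift]
  have h (x : F) : quadraticChar F x * quadraticChar F x = 1 - if x = 0 then 1 else 0 := by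
    split_ifs with hx
    · simp [hx]
    · rw [← sq, quadraticChar_sq_one hx, sub_zero]
  simp only [h, sum_sub_distrib]
  simp

theorem sum_quadraticChar_sub_mul_sub (hF : ringChar F ≠ 2) {a b : F} (hab : a ≠ b) :
    ∑ x, quadraticChar F (a - x) * quadraticChar F (b - x) = -1 := by
  have hd : b - a ≠ 0 := sub_ne_zero.mpr hab.symm
  have h_jacobi := jacobiSum_nontrivial_inv (quadraticChar_ne_one hF)
  rw [(quadraticChar_isQuadratic F).inv, jacobiSum] at h_jacobi
  rw [← ((Equiv.mulLeft₀ (b - a) hd).trans (Equiv.addLeft a)).sum_comp]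
  have h (x : F) : quadraticChar F (a - (a + (b - a) * x)) *
      quadraticChar F (b - (a + (b - a) * x)) =
      quadraticChar F (-1) * (quadraticChar F x * quadraticChar F (1 - x)) := by
    rw [show a - (a + (b - a) * x) = -1 * (b - a) * x by ring,
      show b - (a + (b - a) * x) = (b - a) * (1 - x) by ring]
    simp only [map_mul]
    linear_combination quadraticChar F (-1) * quadraticChar F x * quadraticChar F (1 - x) *
      quadraticChar_sq_one hd
  simp only [Equiv.trans_apply, Equiv.mulLeft₀_apply, Equiv.coe_addLeft, h]
  rw [← mul_sum, h_jacobi]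
  linear_combination -quadraticChar_sq_one (F := F) (neg_ne_zero.mpr one_ne_zero)

variable (F) in
/-- The Paley conference matrix of a finite field: the matrix of quadratic characters of
differences, bordered by a row of ones and a column with entries `quadraticChar F (-1)`. -/
def paleyMatrix : Matrix (Option F) (Option F) ℝ
  | none, none => 0
  | none, some _ => 1
  | some _, none => (quadraticChar F (-1) : ℤ)
  | some a, some b => (quadraticChar F (a - b) : ℤ)

theorem transpose_paleyMatrix :
    (paleyMatrix F)ᵀ = ((quadraticChar F (-1) : ℤ) : ℝ) • paleyMatrix F := by
  have h_sq : quadraticChar F (-1) ^ 2 = 1 := quadraticChar_sq_one (neg_ne_zero.mpr one_ne_zero)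
  ext (_ | a) (_ | b)
  · simp [paleyMatrix]
  · simp [paleyMatrix]
  · simp only [paleyMatrix, transpose_apply, Matrix.smul_apply, smul_eq_mul]
    exact_mod_cast (h_sq.symm.trans (sq _))
  · simp only [paleyMatrix, transpose_apply, Matrix.smul_apply, smul_eq_mul]
    rw [← Int.cast_mul, ← map_mul, neg_one_mul, neg_sub]

theorem isConferenceMatrix_paleyMatrix (hF : ringChar F ≠ 2) :
    IsConferenceMatrix (paleyMatrix F) where
  diag i := by cases i <;> simp [paleyMatrix]
  off_diag := by
    rintro (_ | a) (_ | b) h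
    · exact absurd rfl h
    · exact Or.inl rfl
    · simp only [paleyMatrix]
      exact_mod_cast quadraticChar_dichotomy (F := F) (neg_ne_zero.mpr one_ne_zero)
    · have hab : a - b ≠ 0 := sub_ne_zero.mpr fun hab => h (congrArg some hab)
      simp only [paleyMatrix]
      exact_mod_cast quadraticChar_dichotomy hab
  mul_transpose := by
    have h_sq : quadraticChar F (-1) * quadraticChar F (-1) = 1 := by
      rw [← sq, quadraticChar_sq_one (neg_ne_zero.mpr one_ne_zero)]
    ext (_ | a) (_ | b)
    · simp [Matrix.mul_apply, paleyMatrix]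
    · simp only [Matrix.mul_apply, Fintype.sum_option, paleyMatrix, transpose_apply, zero_mul,
        one_mul, zero_add, Matrix.smul_apply, one_apply_ne (Option.some_ne_none b).symm, smul_zero]
      exact_mod_cast sum_quadraticChar_sub hF b
    · simp only [Matrix.mul_apply, Fintype.sum_option, paleyMatrix, transpose_apply, mul_zero,
        mul_one, zero_add, Matrix.smul_apply, one_apply_ne (Option.some_ne_none a), smul_zero]
      exact_mod_cast sum_quadraticChar_sub hF a
    · simp only [Matrix.mul_apply, Fintype.sum_option, paleyMatrix, transpose_apply, Matrix.smul_apply,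
        Fintype.card_option]
      have h_entry : quadraticChar F (-1) * quadraticChar F (-1) +
          ∑ x, quadraticChar F (a - x) * quadraticChar F (b - x) =
          if a = b then (Fintype.card F : ℤ) else 0 := by
        split_ifs with hab
        · rw [← hab, sum_quadraticChar_sub_mul_self, h_sq]; ring
        · rw [sum_quadraticChar_sub_mul_sub hF hab, h_sq]; ring
      have h_real := congrArg (Int.cast : ℤ → ℝ) h_entry
      push_cast at h_real
      rw [h_real]
      simp [Matrix.one_apply]

end Paley

theorem paley_hadamard (q : ℕ) (hq : q.Prime) :
    (q % 4 = 3 → HadamardOrder (q + 1)) ∧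
    (q % 4 = 1 → HadamardOrder (2 * (q + 1))) := by
  have : Fact q.Prime := ⟨hq⟩
  have h_card : Fintype.card (Option (ZMod q)) = q + 1 := by simp [ZMod.card]
  have h_char (hq2 : q ≠ 2) : ringChar (ZMod q) ≠ 2 := by rwa [ZMod.ringChar_zmod_n]
  constructor <;> intro h_mod
  · have hF := h_char (by omega)
    have h_neg : quadraticChar (ZMod q) (-1) = -1 := by
      rw [quadraticChar_neg_one hF, ZMod.card, ZMod.χ₄_nat_three_mod_four h_mod]
    rw [← h_card]
    refine (isConferenceMatrix_paleyMatrix hF).hadamardOrder_of_skew ?_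
    rw [transpose_paleyMatrix, h_neg]
    simp
  · have hF := h_char (by omega)
    have h_neg : quadraticChar (ZMod q) (-1) = 1 := by
      rw [quadraticChar_neg_one hF, ZMod.card, ZMod.χ₄_nat_one_mod_four h_mod]
    rw [← h_card]
    refine (isConferenceMatrix_paleyMatrix hF).hadamardOrder_of_symm ?_
    rw [transpose_paleyMatrix, h_neg]
    simp
end

section
/- For every ε > 0 there exists x₀ such that for all real x ≥ x₀, S(x) ≥ (3/2 − ε) · x / log x. -/
/-- `S x` is the number of positive integers `n ≤ x` for which a Hadamard matrix
of order `n` exists. -/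
noncomputable def S (x : ℝ) : ℕ :=
  {n : ℕ | 0 < n ∧ (n : ℝ) ≤ x ∧ HadamardOrder n}.ncard

open Finset in
theorem HadamardOrder.of_matrix {ι : Type*} [Fintype ι] [DecidableEq ι] (H : Matrix ι ι ℝ)
    (hent : ∀ i j, H i j = 1 ∨ H i j = -1) (hmul : H * H.transpose = (Fintype.card ι : ℝ) • 1) :
    HadamardOrder (Fintype.card ι) := by
  let e := Fintype.equivFin ι
  refine ⟨H.submatrix e.symm e.symm, fun i j => hent _ _, ?_⟩
  rw [Matrix.transpose_submatrix, Matrix.submatrix_mul_equiv, hmul]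
  ext i j
  simp [Matrix.one_apply]

open scoped Kronecker in
theorem HadamardOrder.mul {m n : ℕ} (hm : HadamardOrder m) (hn : HadamardOrder n) :
    HadamardOrder (m * n) := by
  obtain ⟨H, hH, hHm⟩ := hm
  obtain ⟨K, hK, hKm⟩ := hn
  have h := HadamardOrder.of_matrix (H ⊗ₖ K) (fun i j => ?_) ?_
  · simpa using h
  · rw [Matrix.kronecker_apply]
    rcases hH i.1 j.1 with h | h <;> rcases hK i.2 j.2 with h' | h' <;> simp [h, h']
  · rw [← Matrix.kroneckerMap_transpose, ← Matrix.mul_kronecker_mul, hHm, hKm,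
      Matrix.smul_kronecker, Matrix.kronecker_smul, Matrix.one_kronecker_one, smul_smul]
    simp

/-- A conference matrix of order `m` yields a Hadamard matrix of order `2 * m`. -/
theorem HadamardOrder.of_conference {ι : Type*} [Fintype ι] [DecidableEq ι] (C : Matrix ι ι ℝ)
    (c : ℝ) (hc : c ≠ 0) (hcard : (Fintype.card ι : ℝ) = c + 1) (hdiag : ∀ i, C i i = 0)
    (hoff : ∀ i j, i ≠ j → C i j = 1 ∨ C i j = -1) (hmul : C * C.transpose = c • 1) :
    HadamardOrder (2 * Fintype.card ι) := by
  have hmul' : C.transpose * C = c • 1 := by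
    have h1 : C * (c⁻¹ • C.transpose) = 1 := by
      rw [Matrix.mul_smul, hmul, smul_smul, inv_mul_cancel₀ hc, one_smul]
    have h2 := mul_eq_one_comm.mp h1
    rw [Matrix.smul_mul] at h2
    rw [← h2, smul_smul, mul_inv_cancel₀ hc, one_smul]
  have h := HadamardOrder.of_matrix
    (Matrix.fromBlocks (C + 1) (C - 1) (C.transpose - 1) (-C.transpose - 1)) ?_ ?_
  · simpa [two_mul] using h
  · rintro (i | i) (j | j) <;> by_cases hij : i = j
    all_goals first
      | (subst hij; simp [hdiag])
      | (have hji := hoff j i (Ne.symm hij)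
         have hij' := hoff i j hij
         simp only [Matrix.fromBlocks_apply₁₁, Matrix.fromBlocks_apply₁₂,
           Matrix.fromBlocks_apply₂₁, Matrix.fromBlocks_apply₂₂, Matrix.add_apply,
           Matrix.sub_apply, Matrix.neg_apply, Matrix.transpose_apply, Matrix.one_apply_ne hij]
         grind)
  · have hone : (1 : Matrix (ι ⊕ ι) (ι ⊕ ι) ℝ) = Matrix.fromBlocks 1 0 0 1 :=
      Matrix.fromBlocks_one.symm
    rw [Matrix.fromBlocks_transpose, Matrix.fromBlocks_multiply, hone, Matrix.fromBlocks_smul]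
    have hc2 : ((Fintype.card (ι ⊕ ι) : ℕ) : ℝ) = c + c + 2 := by
      rw [Fintype.card_sum]; push_cast; linarith
    rw [hc2]
    simp only [Matrix.transpose_add, Matrix.transpose_sub, Matrix.transpose_neg,
      Matrix.transpose_transpose, Matrix.transpose_one]
    have h11 : (C + 1) * (C.transpose + 1) + (C - 1) * (C.transpose - 1)
        = (c + c + 2) • (1 : Matrix ι ι ℝ) := by
      simp only [add_smul, ← hmul]
      rw [two_smul]
      noncomm_ring
    have h22 : (C.transpose - 1) * (C - 1) + (-C.transpose - 1) * (-C - 1)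
        = (c + c + 2) • (1 : Matrix ι ι ℝ) := by
      simp only [add_smul, ← hmul']
      rw [two_smul]
      noncomm_ring
    have h12 : (C + 1) * (C - 1) + (C - 1) * (-C - 1) = (0 : Matrix ι ι ℝ) := by
      noncomm_ring
    have h21 : (C.transpose - 1) * (C.transpose + 1) + (-C.transpose - 1) * (C.transpose - 1)
        = (0 : Matrix ι ι ℝ) := by
      noncomm_ring
    rw [h11, h22, h12, h21, smul_zero]

open Finset in
theorem sum_quadraticChar_mul_shift {p : ℕ} [Fact p.Prime] (hp : p ≠ 2) (a b : ZMod p)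
    (hab : a ≠ b) :
    ∑ j, quadraticChar (ZMod p) (a - j) * quadraticChar (ZMod p) (b - j) = -1 := by
  set χ := quadraticChar (ZMod p) with hχ
  have hchar : ringChar (ZMod p) ≠ 2 := by rwa [ZMod.ringChar_zmod_n]
  have hd : b - a ≠ 0 := sub_ne_zero.mpr hab.symm
  have hsum : ∑ x, χ x = 0 := quadraticChar_sum_zero hchar
  have hshift : ∑ j, χ (a - j) * χ (b - j) = ∑ x, χ x * χ (x + (b - a)) := by
    rw [← (Equiv.subLeft a).sum_comp]
    refine sum_congr rfl fun x _ => ?_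
    simp only [Equiv.subLeft_apply, sub_sub_cancel]
    congr 2
    ring
  have hterm : ∀ x, χ x * χ (x + (b - a)) = χ (1 + (b - a) * x⁻¹) - if x = 0 then 1 else 0 := by
    intro x
    by_cases hx : x = 0
    · have h0 : χ 0 = 0 := quadraticChar_zero
      simp [hx, h0]
    · have h1 : x + (b - a) = x * (1 + (b - a) * x⁻¹) := by field_simp
      rw [h1, map_mul, ← mul_assoc, ← sq, quadraticChar_sq_one hx]
      simp [hx]
  rw [hshift, sum_congr rfl fun x _ => hterm x, sum_sub_distrib]
  have hbij : Function.Bijective fun x : ZMod p => 1 + (b - a) * x⁻¹ := by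
    rw [← Finite.injective_iff_bijective]
    intro x y hxy
    have := mul_left_cancel₀ hd (add_left_cancel hxy)
    exact inv_injective this
  rw [hbij.sum_comp (fun x => χ x), hsum]
  simp

open Finset in
theorem hadamardOrder_two_mul_prime_add_one {p : ℕ} (hp : p.Prime) (hp2 : p ≠ 2) :
    HadamardOrder (2 * (p + 1)) := by
  have := Fact.mk hp
  have hchar : ringChar (ZMod p) ≠ 2 := by rwa [ZMod.ringChar_zmod_n]
  obtain ⟨χ, hχ⟩ : ∃ χ, χ = quadraticChar (ZMod p) := ⟨_, rfl⟩
  have hχ0 : χ 0 = 0 := by rw [hχ]; exact quadraticChar_zero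
  have hsum : ∑ x, χ x = 0 := by rw [hχ]; exact quadraticChar_sum_zero hchar
  have hsum' : ∀ a : ZMod p, ∑ j, (χ (a - j) : ℝ) = 0 := by
    intro a
    have := (Equiv.subLeft a).sum_comp (fun x => χ x)
    simp only [Equiv.subLeft_apply] at this
    rw [hsum] at this
    exact_mod_cast this
  obtain ⟨C, h00, h01, h10, h11⟩ : ∃ C : Matrix (Option (ZMod p)) (Option (ZMod p)) ℝ,
      C none none = 0 ∧ (∀ b, C none (some b) = 1) ∧ (∀ a, C (some a) none = 1) ∧
      ∀ a b, C (some a) (some b) = χ (a - b) :=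
    ⟨fun i j => i.elim (j.elim 0 fun _ => 1) fun a => j.elim 1 fun b => (χ (a - b) : ℝ),
      rfl, fun _ => rfl, fun _ => rfl, fun _ _ => rfl⟩
  have h := HadamardOrder.of_conference C p (by exact_mod_cast hp.ne_zero) (by simp)
    (by rintro (_ | a) <;> simp [h00, h11, hχ0]) ?_ ?_
  · simpa using h
  · rintro (_ | a) (_ | b) hab
    · exact absurd rfl hab
    · simp [h01]
    · simp [h10]
    · have : a - b ≠ 0 := sub_ne_zero.mpr fun h => hab (by rw [h])
      rw [h11, hχ]
      exact_mod_cast quadraticChar_dichotomy this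
  · ext i j
    rw [Matrix.mul_apply, Fintype.sum_option]
    simp only [Matrix.transpose_apply]
    rcases i with _ | a <;> rcases j with _ | b
    · simp [h00, h01]
    · simp [h00, h01, h10, h11, hsum']
    · simp [h00, h01, h10, h11, hsum']
    · simp only [h10, h11]
      by_cases hab : a = b
      · subst hab
        have h1 : ∀ j, (χ (a - j) : ℝ) * χ (a - j) = 1 - if j = a then 1 else 0 := by
          intro j
          by_cases hj : j = a
          · simp [hj, hχ0]
          · have h0 : χ (a - j) ^ 2 = 1 := by
              rw [hχ]; exact quadraticChar_sq_one (sub_ne_zero.mpr (Ne.symm hj))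
            have : (χ (a - j) : ℝ) ^ 2 = 1 := by exact_mod_cast h0
            rw [← sq, this]; simp [hj]
        simp [h1]
      · have h1 := sum_quadraticChar_mul_shift hp2 a b hab
        rw [← hχ] at h1
        have h2 : ∑ j, (χ (a - j) : ℝ) * χ (b - j) = -1 := by exact_mod_cast h1
        rw [h2]; simp [hab]

open Finset in
theorem abs_card_filter_modEq_sub_le (N q c : ℕ) (hq : 0 < q) :
    |(#{t ∈ Ioc 0 N | t ≡ c [MOD q]} : ℝ) - N / q| ≤ 1 := by
  have hq' : (0 : ℚ) < q := by exact_mod_cast hq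
  have h := Nat.Ioc_filter_modEq_card 0 N hq c
  have hmono : ⌊((0 : ℕ) - c : ℚ) / q⌋ ≤ ⌊((N : ℚ) - c) / q⌋ := by
    apply Int.floor_le_floor
    gcongr
    exact_mod_cast Nat.zero_le N
  rw [max_eq_left (by linarith)] at h
  have h1 := Int.floor_le (((N : ℚ) - c) / q)
  have h2 := Int.lt_floor_add_one (((N : ℚ) - c) / q)
  have h3 := Int.floor_le ((((0 : ℕ) : ℚ) - c) / q)
  have h4 := Int.lt_floor_add_one ((((0 : ℕ) : ℚ) - c) / q)
  have h5 : ((N : ℚ) - c) / q - (((0 : ℕ) : ℚ) - c) / q = N / q := by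
    rw [← sub_div]; simp
  have hQ : |(#{t ∈ Ioc 0 N | t ≡ c [MOD q]} : ℚ) - N / q| ≤ 1 := by
    have h' : (#{t ∈ Ioc 0 N | t ≡ c [MOD q]} : ℚ)
        = ⌊((N : ℚ) - c) / q⌋ - ⌊(((0 : ℕ) : ℚ) - c) / q⌋ := by exact_mod_cast h
    rw [h', abs_le]
    constructor <;> linarith
  have hR : ((|(#{t ∈ Ioc 0 N | t ≡ c [MOD q]} : ℚ) - N / q| : ℚ) : ℝ) ≤ ((1 : ℚ) : ℝ) :=
    Rat.cast_le.mpr hQ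
  push_cast at hR
  exact hR

open Finset in
theorem abs_card_filter_two_residues_sub_le (N : ℕ) (u v : ℕ → ℕ) (D : Finset ℕ) :
    (∀ l ∈ D, l.Prime) → (∀ l ∈ D, ¬ u l ≡ v l [MOD l]) →
    ∀ q c : ℕ, 0 < q → (∀ l ∈ D, q.Coprime l) →
    |(#{t ∈ Ioc 0 N | t ≡ c [MOD q] ∧ ∀ l ∈ D, t ≡ u l [MOD l] ∨ t ≡ v l [MOD l]} : ℝ)
      - N / q * ∏ l ∈ D, (2 / (l : ℝ))| ≤ 2 ^ #D := by
  induction D using Finset.induction_on with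
  | empty =>
    intro _ _ q c hq _
    simpa using abs_card_filter_modEq_sub_le N q c hq
  | insert l D hl ih =>
    intro hpr huv q c hq hcop
    simp only [forall_mem_insert] at hpr huv hcop
    have key : ∀ w : ℕ, |(#{t ∈ Ioc 0 N | (t ≡ c [MOD q] ∧ t ≡ w [MOD l]) ∧
        ∀ l ∈ D, t ≡ u l [MOD l] ∨ t ≡ v l [MOD l]} : ℝ)
          - N / (q * l : ℕ) * ∏ l ∈ D, (2 / (l : ℝ))| ≤ 2 ^ #D := by
      intro w
      obtain ⟨k, hk1, hk2⟩ := Nat.chineseRemainder hcop.1 c w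
      have h := ih hpr.2 huv.2 (q * l) k (Nat.mul_pos hq hpr.1.pos) fun l' hl' =>
        Nat.Coprime.mul_left (hcop.2 l' hl')
          ((Nat.coprime_primes hpr.1 (hpr.2 l' hl')).mpr fun h => hl (h ▸ hl'))
      have heq : ∀ t, t ≡ k [MOD q * l] ↔ t ≡ c [MOD q] ∧ t ≡ w [MOD l] := fun t => by
        rw [← Nat.modEq_and_modEq_iff_modEq_mul hcop.1]
        exact ⟨fun h => ⟨h.1.trans hk1, h.2.trans hk2⟩,
          fun h => ⟨h.1.trans hk1.symm, h.2.trans hk2.symm⟩⟩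
      simpa only [heq] using h
    have hsplit : #{t ∈ Ioc 0 N | t ≡ c [MOD q] ∧
          ∀ l' ∈ insert l D, t ≡ u l' [MOD l'] ∨ t ≡ v l' [MOD l']}
        = #{t ∈ Ioc 0 N | (t ≡ c [MOD q] ∧ t ≡ u l [MOD l]) ∧
            ∀ l ∈ D, t ≡ u l [MOD l] ∨ t ≡ v l [MOD l]}
        + #{t ∈ Ioc 0 N | (t ≡ c [MOD q] ∧ t ≡ v l [MOD l]) ∧
            ∀ l ∈ D, t ≡ u l [MOD l] ∨ t ≡ v l [MOD l]} := by
      rw [← card_union_of_disjoint]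
      · congr 1
        ext t
        simp only [mem_filter, mem_union, forall_mem_insert]
        tauto
      · rw [disjoint_left]
        intro t h1 h2
        simp only [mem_filter] at h1 h2
        exact huv.1 (h1.2.1.2.symm.trans h2.2.1.2)
    have hl0 : (l : ℝ) ≠ 0 := by exact_mod_cast hpr.1.ne_zero
    have hq0 : (q : ℝ) ≠ 0 := by exact_mod_cast hq.ne'
    have hu := key (u l)
    have hv := key (v l)
    rw [hsplit, prod_insert hl, card_insert_of_notMem hl, pow_succ]
    push_cast at hu hv ⊢
    have : (N : ℝ) / q * (2 / l * ∏ l ∈ D, (2 / (l : ℝ)))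
        = N / (q * l) * ∏ l ∈ D, (2 / (l : ℝ)) + N / (q * l) * ∏ l ∈ D, (2 / (l : ℝ)) := by
      field_simp; ring
    rw [this]
    rw [abs_le] at hu hv ⊢
    constructor <;> linarith

open Finset in
/-- A truncation of inclusion-exclusion at an even level is an upper bound. -/
theorem le_sum_powerset_neg_one_pow {α : Type*} [DecidableEq α] (W : Finset α) {m : ℕ}
    (hm : Even m) :
    (if W = ∅ then (1 : ℝ) else 0) ≤ ∑ D ∈ W.powerset with #D ≤ m, (-1 : ℝ) ^ #D := by
  have h1 : ∑ D ∈ W.powerset with #D ≤ m, (-1 : ℝ) ^ #D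
      = ∑ k ∈ range (m + 1), (-1 : ℝ) ^ k * (#W).choose k := by
    have hmaps : ∀ D ∈ W.powerset.filter (fun D => #D ≤ m), #D ∈ range (m + 1) := by
      intro D hD
      simp only [mem_filter] at hD
      exact mem_range.mpr (by omega)
    rw [← sum_fiberwise_of_maps_to hmaps]
    refine sum_congr rfl fun k hk => ?_
    have : {D ∈ W.powerset.filter (fun D => #D ≤ m) | #D = k} = W.powersetCard k := by
      ext D
      simp only [mem_filter, mem_powerset, mem_powersetCard]
      have := mem_range.mp hk
      constructor
      · rintro ⟨⟨a, b⟩, c⟩; exact ⟨a, c⟩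
      · rintro ⟨a, c⟩; exact ⟨⟨a, by omega⟩, c⟩
    rw [this, sum_congr rfl fun D hD => by rw [(mem_powersetCard.mp hD).2], sum_const,
      card_powersetCard, nsmul_eq_mul, mul_comm]
  rw [h1]
  split_ifs with hW
  · subst hW
    rw [sum_range_succ']
    simp
  · obtain ⟨n, hn⟩ : ∃ n, #W = n + 1 :=
      Nat.exists_eq_succ_of_ne_zero (by simpa using hW)
    have h2 := Int.alternating_sum_range_choose_eq_choose (n := n) (m := m)
    rw [hm.neg_one_pow, one_mul] at h2
    rw [hn]
    have h3 : ∑ k ∈ range (m + 1), (-1 : ℝ) ^ k * ((n + 1).choose k : ℝ) = n.choose m := by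
      exact_mod_cast h2
    rw [h3]
    positivity

open Finset in
/-- Brun's pure sieve for two residue classes modulo each prime. -/
theorem card_sifted_le (N m z : ℕ) (hm : Even m) (hz : 0 < z) (u v : ℕ → ℕ) (P : Finset ℕ)
    (hP : ∀ l ∈ P, l.Prime) (huv : ∀ l ∈ P, ¬ u l ≡ v l [MOD l]) (hPz : #P ≤ z) :
    (#{t ∈ Ioc 0 N | ∀ l ∈ P, ¬ (t ≡ u l [MOD l] ∨ t ≡ v l [MOD l])} : ℝ)
      ≤ N * (Real.exp (-2 * ∑ l ∈ P, (1 / (l : ℝ))) + Real.exp (6 * ∑ l ∈ P, (1 / (l : ℝ)) - m))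
        + 3 * (2 * z) ^ m := by
  have hl0 : ∀ l ∈ P, (0 : ℝ) < l := fun l hl => by exact_mod_cast (hP l hl).pos
  set g : Finset ℕ → ℝ := fun D => ∏ l ∈ D, (2 / (l : ℝ)) with hg
  have hg0 : ∀ D, 0 ≤ g D := fun D => prod_nonneg fun l _ => by positivity
  set F := P.powerset.filter (fun D => #D ≤ m) with hF
  set cnt : Finset ℕ → ℝ := fun D =>
    (#{t ∈ Ioc 0 N | ∀ l ∈ D, t ≡ u l [MOD l] ∨ t ≡ v l [MOD l]} : ℝ) with hcnt
  have hcount : ∀ D ∈ P.powerset, |cnt D - N * g D| ≤ 2 ^ #D := by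
    intro D hD
    have hDP := mem_powerset.mp hD
    have h := abs_card_filter_two_residues_sub_le N u v D (fun l hl => hP l (hDP hl))
      (fun l hl => huv l (hDP hl)) 1 0 one_pos (fun l _ => Nat.coprime_one_left l)
    simpa only [Nat.modEq_one, true_and, Nat.cast_one, div_one] using h
  have hincl_excl : (#{t ∈ Ioc 0 N | ∀ l ∈ P, ¬ (t ≡ u l [MOD l] ∨ t ≡ v l [MOD l])} : ℝ)
      ≤ ∑ D ∈ F, (-1 : ℝ) ^ #D * cnt D := by
    have hpt : ∀ t, (if ∀ l ∈ P, ¬ (t ≡ u l [MOD l] ∨ t ≡ v l [MOD l]) then (1 : ℝ) else 0)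
        ≤ ∑ D ∈ F, (-1 : ℝ) ^ #D *
          (if ∀ l ∈ D, t ≡ u l [MOD l] ∨ t ≡ v l [MOD l] then 1 else 0) := by
      intro t
      have h := le_sum_powerset_neg_one_pow
        (P.filter fun l => t ≡ u l [MOD l] ∨ t ≡ v l [MOD l]) hm
      simp only [filter_eq_empty_iff] at h
      refine h.trans (le_of_eq ?_)
      simp only [mul_ite, mul_one, mul_zero]
      rw [← sum_filter]
      refine sum_congr ?_ fun _ _ => rfl
      ext D
      simp only [hF, mem_filter, mem_powerset, subset_iff]
      constructor
      · rintro ⟨a, b⟩; exact ⟨⟨fun l hl => (a hl).1, b⟩, fun l hl => (a hl).2⟩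
      · rintro ⟨⟨a, b⟩, c⟩; exact ⟨fun l hl => ⟨a hl, c l hl⟩, b⟩
    calc (#{t ∈ Ioc 0 N | ∀ l ∈ P, ¬ (t ≡ u l [MOD l] ∨ t ≡ v l [MOD l])} : ℝ)
        = ∑ t ∈ Ioc 0 N, (if ∀ l ∈ P, ¬ (t ≡ u l [MOD l] ∨ t ≡ v l [MOD l]) then (1 : ℝ)
            else 0) := by rw [sum_boole]
      _ ≤ ∑ t ∈ Ioc 0 N, ∑ D ∈ F, (-1 : ℝ) ^ #D *
          (if ∀ l ∈ D, t ≡ u l [MOD l] ∨ t ≡ v l [MOD l] then 1 else 0) :=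
          sum_le_sum fun t _ => hpt t
      _ = ∑ D ∈ F, (-1 : ℝ) ^ #D * cnt D := by
          rw [sum_comm]
          refine sum_congr rfl fun D _ => ?_
          rw [← mul_sum, sum_boole]
  have hmain_term : ∑ D ∈ F, (-1 : ℝ) ^ #D * cnt D
      ≤ ∑ D ∈ F, (N * ((-1 : ℝ) ^ #D * g D) + 2 ^ #D) := by
    refine sum_le_sum fun D hD => ?_
    have h := abs_le.mp (hcount D (mem_filter.mp hD).1)
    rcases neg_one_pow_eq_or ℝ #D with h1 | h1 <;> rw [h1] <;> linarith
  have hfull : ∑ D ∈ P.powerset, (-1 : ℝ) ^ #D * g D ≤ Real.exp (-2 * ∑ l ∈ P, (1 / (l : ℝ))) := by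
    have h1 : ∑ D ∈ P.powerset, (-1 : ℝ) ^ #D * g D = ∏ l ∈ P, (1 + -(2 / (l : ℝ))) := by
      rw [prod_one_add]
      refine sum_congr rfl fun D _ => ?_
      rw [prod_neg]
    rw [h1, mul_sum, Real.exp_sum]
    refine prod_le_prod (fun l hl => ?_) fun l hl => ?_
    · have : (2 : ℝ) ≤ l := by exact_mod_cast (hP l hl).two_le
      have := (div_le_one (hl0 l hl)).mpr this
      linarith
    · have := Real.add_one_le_exp (-2 * (1 / (l : ℝ)))
      calc 1 + -(2 / (l : ℝ)) = -2 * (1 / (l : ℝ)) + 1 := by ring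
        _ ≤ _ := this
  have htail : ∑ D ∈ P.powerset with ¬ #D ≤ m, g D
      ≤ Real.exp (6 * ∑ l ∈ P, (1 / (l : ℝ)) - m) := by
    have h1 : ∑ D ∈ P.powerset with ¬ #D ≤ m, g D
        ≤ ∑ D ∈ P.powerset, Real.exp (-m) * ∏ l ∈ D, (Real.exp 1 * (2 / (l : ℝ))) := by
      refine (sum_le_sum fun D hD => ?_).trans
        (sum_le_sum_of_subset_of_nonneg (filter_subset _ _) fun D _ _ => ?_)
      · have hD := (mem_filter.mp hD).2
        rw [prod_mul_distrib, prod_const, ← Real.exp_nat_mul, ← mul_assoc, ← Real.exp_add]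
        have : (1 : ℝ) ≤ Real.exp (-m + #D * 1) := by
          apply Real.one_le_exp
          have : (m : ℝ) ≤ #D := by exact_mod_cast (not_le.mp hD).le
          linarith
        exact le_mul_of_one_le_left (hg0 D) this
      · have : 0 ≤ ∏ l ∈ D, (Real.exp 1 * (2 / (l : ℝ))) := prod_nonneg fun l _ => by positivity
        positivity
    refine h1.trans ?_
    rw [← mul_sum, ← prod_one_add, sub_eq_neg_add, Real.exp_add]
    refine mul_le_mul_of_nonneg_left ?_ (Real.exp_pos _).le
    rw [mul_sum, Real.exp_sum]
    refine prod_le_prod (fun l hl => by positivity) fun l hl => ?_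
    have h3 := Real.exp_one_lt_d9
    have h4 := Real.add_one_le_exp (6 * (1 / (l : ℝ)))
    have h5 : 0 < 1 / (l : ℝ) := one_div_pos.mpr (hl0 l hl)
    have h6 : Real.exp 1 * (2 / (l : ℝ)) = 2 * Real.exp 1 * (1 / l) := by ring
    rw [h6]
    nlinarith
  have herr : ∑ D ∈ F, (2 : ℝ) ^ #D ≤ 3 * (2 * z) ^ m := by
    have hz1 : (1 : ℝ) ≤ z := by exact_mod_cast hz
    have h1 : ∑ D ∈ F, (2 : ℝ) ^ #D ≤
        ∑ D ∈ P.powerset, (2 * (z : ℝ)) ^ m * ∏ l ∈ D, (1 / (z : ℝ)) := by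
      refine (sum_le_sum fun D hD => ?_).trans
        (sum_le_sum_of_subset_of_nonneg (filter_subset _ _) fun D _ _ => by positivity)
      have hD := (mem_filter.mp hD).2
      rw [prod_const, mul_pow, one_div, inv_pow, mul_assoc]
      refine mul_le_mul (pow_le_pow_right₀ one_le_two hD) le_rfl zero_le_one (by positivity)
        |>.trans ?_ |> (mul_one ((2 : ℝ) ^ #D)).symm.le.trans
      refine mul_le_mul_of_nonneg_left ?_ (by positivity)
      rw [← div_eq_mul_inv, one_le_div (by positivity)]
      exact pow_le_pow_right₀ hz1 hD
    refine h1.trans ?_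
    rw [← mul_sum, ← prod_one_add, prod_const, mul_comm]
    refine mul_le_mul_of_nonneg_right ?_ (by positivity)
    calc (1 + 1 / (z : ℝ)) ^ #P ≤ (1 + 1 / (z : ℝ)) ^ z :=
          pow_le_pow_right₀ (by have : 0 < 1 / (z : ℝ) := by positivity
                                linarith) hPz
      _ ≤ (Real.exp (1 / z)) ^ z := by
          gcongr
          linarith [Real.add_one_le_exp (1 / (z : ℝ))]
      _ = Real.exp 1 := by
          rw [← Real.exp_nat_mul]
          congr 1
          field_simp
      _ ≤ 3 := by linarith [Real.exp_one_lt_d9]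
  have hmain : ∑ D ∈ F, (-1 : ℝ) ^ #D * g D
      ≤ Real.exp (-2 * ∑ l ∈ P, (1 / (l : ℝ))) + Real.exp (6 * ∑ l ∈ P, (1 / (l : ℝ)) - m) := by
    have h1 := sum_filter_add_sum_filter_not P.powerset (fun D => #D ≤ m)
      (fun D => (-1 : ℝ) ^ #D * g D)
    have h2 : -(∑ D ∈ P.powerset with ¬ #D ≤ m, (-1 : ℝ) ^ #D * g D)
        ≤ ∑ D ∈ P.powerset with ¬ #D ≤ m, g D := by
      rw [← sum_neg_distrib]
      refine sum_le_sum fun D _ => ?_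
      have := hg0 D
      rcases neg_one_pow_eq_or ℝ #D with h1 | h1 <;> rw [h1] <;> linarith
    linarith
  rw [sum_add_distrib, ← mul_sum] at hmain_term
  have hN : (0 : ℝ) ≤ N := N.cast_nonneg
  have := mul_le_mul_of_nonneg_left hmain hN
  linarith

open Finset in
theorem exists_subset_sum_mem_Icc {α : Type*} [DecidableEq α] (f : α → ℝ) (s : Finset α)
    (hf : ∀ a ∈ s, f a ≤ 1) {τ : ℝ} (hτ : 0 ≤ τ) (h : τ ≤ ∑ a ∈ s, f a) :
    ∃ t ⊆ s, τ ≤ ∑ a ∈ t, f a ∧ ∑ a ∈ t, f a ≤ τ + 1 := by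
  induction s using Finset.induction_on with
  | empty =>
    refine ⟨∅, subset_rfl, h, ?_⟩
    simp; linarith
  | insert a s ha ih =>
    simp only [forall_mem_insert] at hf
    by_cases hs : τ ≤ ∑ a ∈ s, f a
    · obtain ⟨t, ht, h1⟩ := ih hf.2 hs
      exact ⟨t, ht.trans (subset_insert _ _), h1⟩
    · refine ⟨insert a s, subset_rfl, h, ?_⟩
      rw [sum_insert ha]
      linarith [hf.1]

open Finset in
theorem log_le_prod_primesBelow (n : ℕ) (hn : 0 < n) :
    Real.log n ≤ ∏ p ∈ n.primesBelow, (1 - (p : ℝ)⁻¹)⁻¹ := by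
  let f : ℕ →* ℝ :=
    { toFun := fun k => (k : ℝ)⁻¹, map_one' := by simp, map_mul' := fun a b => by
        rw [Nat.cast_mul, mul_inv] }
  have hf : ∀ {p : ℕ}, p.Prime → ‖f p‖ < 1 := fun {p} hp => by
    change ‖((p : ℝ)⁻¹)‖ < 1
    rw [norm_inv, Real.norm_natCast]
    exact inv_lt_one_of_one_lt₀ (by exact_mod_cast hp.one_lt)
  obtain ⟨h1, h2⟩ := EulerProduct.summable_and_hasSum_smoothNumbers_prod_primesBelow_geometric hf n
  have h3 : ∏ p ∈ n.primesBelow, (1 - (p : ℝ)⁻¹)⁻¹ = ∏ p ∈ n.primesBelow, (1 - f p)⁻¹ := rfl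
  rw [h3]
  let e : (Finset.Ico 1 n) → n.smoothNumbers := fun k =>
    ⟨k.1, Nat.mem_smoothNumbers_of_lt (mem_Ico.mp k.2).1 (mem_Ico.mp k.2).2⟩
  have he : Function.Injective e := fun a b hab => Subtype.ext (congrArg (fun x => x.1) hab)
  have h4 := sum_le_hasSum (univ.map ⟨e, he⟩) (fun i _ => by
    change (0 : ℝ) ≤ ((i : ℕ) : ℝ)⁻¹
    positivity) h2
  refine le_trans ?_ h4
  rw [sum_map]
  have h5 : ∑ x, f ((e x : n.smoothNumbers) : ℕ) = ∑ k ∈ Ico 1 n, (k : ℝ)⁻¹ := by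
    rw [← sum_coe_sort (Ico 1 n)]; rfl
  have h6 := log_add_one_le_harmonic (n - 1)
  have h7 : ((n - 1 : ℕ) : ℝ) + 1 = n := by
    have : (n - 1) + 1 = n := by omega
    exact_mod_cast this
  push_cast at h6
  rw [h7] at h6
  refine h6.trans (le_of_eq ?_)
  rw [harmonic_eq_sum_Icc]
  push_cast
  refine Eq.trans ?_ h5.symm
  refine sum_congr ?_ fun _ _ => rfl
  ext k; simp only [mem_Icc, mem_Ico]; omega

open Finset in
/-- A lower bound of Mertens type for the sum of the reciprocals of the primes. -/
theorem log_log_le_sum_primesBelow (n : ℕ) (hn : 2 ≤ n) :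
    Real.log (Real.log n) ≤ ∑ p ∈ n.primesBelow, (1 / (p : ℝ)) + 1 := by
  have hlog : 0 < Real.log n := Real.log_pos (by exact_mod_cast hn)
  have h1 := log_le_prod_primesBelow n (by omega)
  have h2 : ∏ p ∈ n.primesBelow, (1 - (p : ℝ)⁻¹)⁻¹
      ≤ Real.exp (∑ p ∈ n.primesBelow, (1 / ((p : ℝ) - 1))) := by
    rw [Real.exp_sum]
    refine prod_le_prod (fun p hp => ?_) fun p hp => ?_
    all_goals
      have hp2 : (2 : ℝ) ≤ p := by exact_mod_cast (Nat.prime_of_mem_primesBelow hp).two_le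
    · rw [inv_nonneg, sub_nonneg]
      exact inv_le_one_of_one_le₀ (by linarith)
    · have h3 : (1 - (p : ℝ)⁻¹)⁻¹ = 1 / ((p : ℝ) - 1) + 1 := by
        have : (p : ℝ) - 1 ≠ 0 := by linarith
        have : (p : ℝ) ≠ 0 := by linarith
        have h : 1 - (p : ℝ)⁻¹ = ((p : ℝ) - 1) / p := by field_simp
        rw [h, inv_div]
        field_simp
        ring
      rw [h3]
      exact Real.add_one_le_exp _
  have h3 := Real.log_le_log hlog (h1.trans h2)
  rw [Real.log_exp] at h3
  have h4 : ∑ p ∈ n.primesBelow, (1 / ((p : ℝ) - 1) - 1 / (p : ℝ)) ≤ 1 := by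
    have hnn : ∀ k ∈ Ico 2 n, (0 : ℝ) ≤ 1 / ((k : ℝ) - 1) - 1 / k := fun k hk => by
      have hk2 : (2 : ℝ) ≤ k := by exact_mod_cast (mem_Ico.mp hk).1
      rw [sub_nonneg]
      exact one_div_le_one_div_of_le (by linarith) (by linarith)
    have hsub : n.primesBelow ⊆ Ico 2 n := fun p hp => mem_Ico.mpr
      ⟨(Nat.prime_of_mem_primesBelow hp).two_le, Nat.lt_of_mem_primesBelow hp⟩
    refine (sum_le_sum_of_subset_of_nonneg hsub fun k hk _ => hnn k hk).trans ?_
    have htel : ∀ m : ℕ, 2 ≤ m → ∑ k ∈ Ico 2 m, (1 / ((k : ℝ) - 1) - 1 / k)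
        = 1 - 1 / ((m : ℝ) - 1) := by
      intro m hm
      induction m, hm using Nat.le_induction with
      | base => norm_num
      | succ m hm ih => rw [sum_Ico_succ_top hm, ih]; push_cast; ring
    rw [htel n hn]
    have hn2 : (2 : ℝ) ≤ n := by exact_mod_cast hn
    have : 0 ≤ 1 / ((n : ℝ) - 1) := one_div_nonneg.mpr (by linarith)
    linarith
  rw [sum_sub_distrib] at h4
  linarith

open Filter Topology Asymptotics in
theorem eventually_log_rpow_mul_le (C : ℝ) :
    ∀ᶠ y : ℝ in atTop, (Real.log 4 + y ^ (3 / 4 : ℝ)) * (4 * Real.log y + C) ≤ y / 2 := by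
  have h1 : (fun y : ℝ => Real.log 4 + y ^ (3 / 4 : ℝ)) =O[atTop] fun y : ℝ => y ^ (3 / 4 : ℝ) := by
    refine IsBigO.add (IsLittleO.isBigO ?_) (isBigO_refl _ _)
    refine isLittleO_const_left.mpr (Or.inr ?_)
    exact tendsto_norm_atTop_atTop.comp (tendsto_rpow_atTop (by norm_num))
  have h2 : (fun y : ℝ => 4 * Real.log y + C) =o[atTop] fun y : ℝ => y ^ (1 / 4 : ℝ) := by
    refine IsLittleO.add ((isLittleO_log_rpow_atTop (by norm_num)).const_mul_left 4) ?_
    refine isLittleO_const_left.mpr (Or.inr ?_)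
    exact tendsto_norm_atTop_atTop.comp (tendsto_rpow_atTop (by norm_num))
  have h3 := (h1.mul_isLittleO h2).def (c := 1 / 2) (by norm_num)
  filter_upwards [h3, eventually_gt_atTop 0] with y hy hy0
  rw [← Real.rpow_add hy0] at hy
  norm_num at hy
  rw [abs_of_pos hy0, ← abs_mul] at hy
  have := le_abs_self ((Real.log 4 + y ^ (3 / 4 : ℝ)) * (4 * Real.log y + C))
  linarith

open Filter Topology Asymptotics in
theorem eventually_exp_half_le {c : ℝ} (hc : 0 < c) :
    ∀ᶠ y : ℝ in atTop, Real.exp (y / 2) ≤ c * (Real.exp y / y) := by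
  have h := (isLittleO_pow_exp_pos_mul_atTop 1 (b := 1 / 2) (by norm_num)).def hc
  filter_upwards [h, eventually_gt_atTop 0] with y hy hy0
  rw [pow_one, Real.norm_of_nonneg hy0.le, Real.norm_of_nonneg (Real.exp_pos _).le] at hy
  rw [mul_div_assoc', le_div_iff₀ hy0]
  have : Real.exp y = Real.exp (1 / 2 * y) * Real.exp (1 / 2 * y) := by
    rw [← Real.exp_add]; congr 1; ring
  rw [this, show y / 2 = 1 / 2 * y by ring]
  nlinarith [Real.exp_pos (1 / 2 * y)]

open Finset Filter in
/-- Simultaneous primality of two distinct linear forms is rarer than primality. -/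
theorem eventually_card_prime_pairs_le {A B : ℕ} (hA : 0 < A) (hB : 0 < B) (hAB : A ≠ B)
    {η : ℝ} (hη : 0 < η) :
    ∀ᶠ N : ℕ in atTop,
      (#{t ∈ Ioc 0 N | (A * t - 1).Prime ∧ (B * t - 1).Prime} : ℝ) ≤ η * (N / Real.log N) := by
  obtain ⟨K, hK0, hK⟩ : ∃ K : ℝ, 0 ≤ K ∧ Real.exp (-2 * K) ≤ η / 4 := by
    refine ⟨max 0 (-Real.log (η / 4) / 2), le_max_left _ _, ?_⟩
    rw [← Real.le_log_iff_exp_le (by positivity)]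
    have := le_max_right 0 (-Real.log (η / 4) / 2)
    linarith
  have hinv : ∀ C : ℕ, 0 < C → ∀ l, ∃ w, l.Prime → C < l → C * w ≡ 1 [MOD l] := by
    intro C hC l
    by_cases h : l.Prime ∧ C < l
    · have hcop : Nat.Coprime C l := (Nat.coprime_of_lt_prime hC.ne' h.2 h.1).symm
      obtain ⟨w, -, hw⟩ := Nat.exists_mul_mod_eq_one_of_coprime hcop h.1.one_lt
      refine ⟨w, fun _ _ => ?_⟩
      rw [Nat.ModEq, hw, Nat.mod_eq_of_lt h.1.one_lt]
    · exact ⟨0, fun h1 h2 => absurd ⟨h1, h2⟩ h⟩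
  choose u hu using hinv A hA
  choose v hv using hinv B hB
  set L := A + B with hL
  have hlogtop : Tendsto (fun N : ℕ => Real.log N) atTop atTop :=
    Real.tendsto_log_atTop.comp tendsto_natCast_atTop_atTop
  have hev : ∀ᶠ y : ℝ in atTop, 1 ≤ y ∧ 4 * (K + 1 + L) ≤ Real.log y ∧
      (Real.log 4 + y ^ (3 / 4 : ℝ)) * (4 * Real.log y + (8 * K + 10)) ≤ y / 2 ∧
      Real.exp (y / 2) ≤ η / 8 * (Real.exp y / y) :=
    (eventually_ge_atTop 1).and <| (Real.tendsto_log_atTop.eventually_ge_atTop _).and <|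
      (eventually_log_rpow_mul_le _).and <| eventually_exp_half_le (by positivity)
  filter_upwards [hlogtop.eventually hev, eventually_gt_atTop 0] with N hN hN0
  obtain ⟨hy1, hylog, hy3, hy4⟩ := hN
  have hexpN : Real.exp (Real.log N) = N := Real.exp_log (by exact_mod_cast hN0)
  rw [hexpN] at hy4
  set y := Real.log N with hy
  have hy0 : 0 < y := by linarith
  have hlogy : 0 ≤ Real.log y := Real.log_nonneg hy1
  have hr1 : 1 ≤ y ^ (3 / 4 : ℝ) := Real.one_le_rpow hy1 (by norm_num)
  set n := ⌈Real.exp (y ^ (3 / 4 : ℝ))⌉₊ with hn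
  have hn_ge : Real.exp (y ^ (3 / 4 : ℝ)) ≤ n := Nat.le_ceil _
  have hexp2 : 2 ≤ Real.exp (y ^ (3 / 4 : ℝ)) := by
    have := Real.add_one_le_exp (y ^ (3 / 4 : ℝ)); linarith
  have hn2 : 2 ≤ n := by exact_mod_cast hexp2.trans hn_ge
  have hn_le : (2 : ℝ) * n ≤ Real.exp (Real.log 4 + y ^ (3 / 4 : ℝ)) := by
    rw [Real.exp_add, Real.exp_log (by norm_num)]
    have := Nat.ceil_lt_add_one (Real.exp_pos (y ^ (3 / 4 : ℝ))).le
    rw [← hn] at this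
    linarith
  have hmert := log_log_le_sum_primesBelow n hn2
  have hloglog : 3 / 4 * Real.log y ≤ Real.log (Real.log n) := by
    rw [← Real.log_rpow hy0]
    refine Real.log_le_log (by positivity) ?_
    rwa [Real.le_log_iff_exp_le (by positivity)]
  have hsmall : ∑ p ∈ n.primesBelow with ¬ L < p, (1 / (p : ℝ)) ≤ L := by
    have h1 : ∑ p ∈ n.primesBelow with ¬ L < p, (1 / (p : ℝ)) ≤ ∑ p ∈ Ioc 0 L, (1 : ℝ) := by
      refine (sum_le_sum fun p hp => ?_).trans
        (sum_le_sum_of_subset_of_nonneg (fun p hp => ?_) fun _ _ _ => zero_le_one)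
      · have := (Nat.prime_of_mem_primesBelow (mem_filter.mp hp).1).pos
        have : (1 : ℝ) ≤ p := by exact_mod_cast this
        exact (div_le_one (by linarith)).mpr this
      · rw [mem_filter] at hp
        exact mem_Ioc.mpr ⟨(Nat.prime_of_mem_primesBelow hp.1).pos, not_lt.mp hp.2⟩
    simpa using h1
  have hsplit := sum_filter_add_sum_filter_not n.primesBelow (fun p => L < p)
    (fun p => 1 / (p : ℝ))
  obtain ⟨P, hPsub, hT1, hT2⟩ := exists_subset_sum_mem_Icc (fun p : ℕ => 1 / (p : ℝ))
    (n.primesBelow.filter fun p => L < p) (fun p hp => by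
      have := (Nat.prime_of_mem_primesBelow (mem_filter.mp hp).1).pos
      have : (1 : ℝ) ≤ p := by exact_mod_cast this
      exact (div_le_one (by linarith)).mpr this)
    (τ := 1 / 2 * Real.log y + K) (by positivity) (by linarith)
  set T := ∑ p ∈ P, (1 / (p : ℝ)) with hT
  have hT0 : 0 ≤ T := by positivity
  have hPp : ∀ l ∈ P, l.Prime := fun l hl =>
    Nat.prime_of_mem_primesBelow (mem_filter.mp (hPsub hl)).1
  have hPL : ∀ l ∈ P, L < l := fun l hl => (mem_filter.mp (hPsub hl)).2
  have hPn : ∀ l ∈ P, l < n := fun l hl =>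
    Nat.lt_of_mem_primesBelow (mem_filter.mp (hPsub hl)).1
  have huA : ∀ l ∈ P, A * u l ≡ 1 [MOD l] := fun l hl =>
    hu l (hPp l hl) (by have := hPL l hl; omega)
  have hvB : ∀ l ∈ P, B * v l ≡ 1 [MOD l] := fun l hl =>
    hv l (hPp l hl) (by have := hPL l hl; omega)
  have huv : ∀ l ∈ P, ¬ u l ≡ v l [MOD l] := by
    intro l hl h
    have hlL := hPL l hl
    have h1 : B * u l ≡ 1 [MOD l] := (h.mul_left B).trans (hvB l hl)
    have h2 : A * u l ≡ B * u l [MOD l] := (huA l hl).trans h1.symm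
    have h3 : A * (u l * A) ≡ B * (u l * A) [MOD l] := by
      simpa only [mul_assoc] using h2.mul_right A
    have h4 : u l * A ≡ 1 [MOD l] := by simpa only [mul_comm] using huA l hl
    have h5 : A ≡ B [MOD l] := by
      simpa using ((h4.mul_left A).symm.trans h3).trans (h4.mul_left B)
    exact hAB (Nat.ModEq.eq_of_lt_of_lt h5 (by omega) (by omega))
  set m := 2 * ⌈4 * T⌉₊ with hm
  have hm1 : 8 * T ≤ m := by
    have := Nat.le_ceil (4 * T)
    rw [hm]; push_cast; linarith
  have hm2 : (m : ℝ) ≤ 4 * Real.log y + (8 * K + 10) := by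
    have := Nat.ceil_lt_add_one (a := 4 * T) (by positivity)
    rw [hm]; push_cast; linarith
  have hPcard : #P ≤ n := by
    calc #P ≤ #(range n) := card_le_card fun l hl => mem_range.mpr (hPn l hl)
      _ = n := card_range n
  have hsieve := card_sifted_le N m n (even_two_mul _) (by omega) u v P hPp huv hPcard
  have hsubset : {t ∈ Ioc 0 N | (A * t - 1).Prime ∧ (B * t - 1).Prime} ⊆ Ioc 0 n ∪
      {t ∈ Ioc 0 N | ∀ l ∈ P, ¬ (t ≡ u l [MOD l] ∨ t ≡ v l [MOD l])} := by
    intro t ht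
    simp only [mem_filter, mem_union, mem_Ioc] at ht ⊢
    by_cases htn : t ≤ n
    · exact Or.inl ⟨ht.1.1, htn⟩
    · refine Or.inr ⟨ht.1, fun l hl h => ?_⟩
      have hdvd : ∀ C w : ℕ, 0 < C → C * w ≡ 1 [MOD l] → t ≡ w [MOD l] →
          (C * t - 1).Prime → False := by
        intro C w hC hw htw hpr
        have h1 : 1 ≡ C * t [MOD l] := ((htw.mul_left C).trans hw).symm
        have h2 : t ≤ C * t := Nat.le_mul_of_pos_left t hC
        have h3 := (Nat.modEq_iff_dvd' (by omega)).mp h1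
        have h4 := (Nat.prime_dvd_prime_iff_eq (hPp l hl) hpr).mp h3
        have := hPn l hl
        omega
      rcases h with h | h
      · exact hdvd A (u l) hA (huA l hl) h ht.2.1
      · exact hdvd B (v l) hB (hvB l hl) h ht.2.2
  have hcard : (#{t ∈ Ioc 0 N | (A * t - 1).Prime ∧ (B * t - 1).Prime} : ℝ) ≤ n +
      #{t ∈ Ioc 0 N | ∀ l ∈ P, ¬ (t ≡ u l [MOD l] ∨ t ≡ v l [MOD l])} := by
    have h := (card_le_card hsubset).trans (card_union_le _ _)
    rw [Nat.card_Ioc, Nat.sub_zero] at h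
    exact_mod_cast h
  have hr0 : 0 ≤ Real.log 4 + y ^ (3 / 4 : ℝ) := by
    have := Real.log_nonneg (show (1 : ℝ) ≤ 4 by norm_num)
    linarith
  have hpow : (2 * (n : ℝ)) ^ m ≤ Real.exp (y / 2) := by
    calc (2 * (n : ℝ)) ^ m ≤ Real.exp (Real.log 4 + y ^ (3 / 4 : ℝ)) ^ m := by gcongr
      _ = Real.exp (m * (Real.log 4 + y ^ (3 / 4 : ℝ))) := (Real.exp_nat_mul _ _).symm
      _ ≤ Real.exp (y / 2) := by
        refine Real.exp_le_exp.mpr (le_trans ?_ hy3)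
        rw [mul_comm]
        exact mul_le_mul_of_nonneg_left hm2 hr0
  have hnle : (n : ℝ) ≤ Real.exp (y / 2) := by
    have h1 : Real.exp (Real.log 4 + y ^ (3 / 4 : ℝ)) ≤ Real.exp (y / 2) := by
      refine Real.exp_le_exp.mpr (le_trans ?_ hy3)
      exact le_mul_of_one_le_right hr0 (by linarith)
    have : (0 : ℝ) ≤ n := n.cast_nonneg
    linarith
  have hexpT : Real.exp (-2 * T) ≤ η / 4 / y := by
    calc Real.exp (-2 * T) ≤ Real.exp (-2 * K + -Real.log y) := Real.exp_le_exp.mpr (by linarith)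
      _ = Real.exp (-2 * K) / y := by
        rw [Real.exp_add, Real.exp_neg, Real.exp_log hy0, div_eq_mul_inv]
      _ ≤ η / 4 / y := by gcongr
  have hexpT2 : Real.exp (6 * T - m) ≤ η / 4 / y :=
    (Real.exp_le_exp.mpr (by linarith)).trans hexpT
  have hfin : (N : ℝ) * (Real.exp (-2 * T) + Real.exp (6 * T - m)) ≤ η / 2 * (N / y) := by
    calc (N : ℝ) * (Real.exp (-2 * T) + Real.exp (6 * T - m))
        ≤ N * (η / 4 / y + η / 4 / y) := by gcongr
      _ = η / 2 * (N / y) := by ring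
  linarith

open Finset in
/-- A Bonferroni-type lower bound for the size of a union with small pairwise overlaps. -/
theorem sum_card_le_card_biUnion_add {ι α : Type*} [DecidableEq ι] [DecidableEq α]
    (s : Finset ι) (V : ι → Finset α) {c : ℝ}
    (h : ∀ i ∈ s, ∀ j ∈ s, i ≠ j → (#(V i ∩ V j) : ℝ) ≤ c) (hc : 0 ≤ c) :
    ∑ i ∈ s, (#(V i) : ℝ) ≤ #(s.biUnion V) + (#s : ℝ) ^ 2 * c := by
  induction s using Finset.induction_on with
  | empty => simp
  | insert a s ha ih =>
    have ih' := ih fun i hi j hj => h i (mem_insert_of_mem hi) j (mem_insert_of_mem hj)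
    have hinter : (#(V a ∩ s.biUnion V) : ℝ) ≤ #s * c := by
      have h1 : #(V a ∩ s.biUnion V) ≤ ∑ j ∈ s, #(V a ∩ V j) := by
        rw [inter_biUnion]
        exact card_biUnion_le
      calc (#(V a ∩ s.biUnion V) : ℝ) ≤ ∑ j ∈ s, (#(V a ∩ V j) : ℝ) := by exact_mod_cast h1
        _ ≤ ∑ j ∈ s, c := sum_le_sum fun j hj =>
            h a (mem_insert_self a s) j (mem_insert_of_mem hj) fun e => ha (e ▸ hj)
        _ = #s * c := by rw [sum_const, nsmul_eq_mul]
    have hunion : (#(V a ∪ s.biUnion V) : ℝ) + #(V a ∩ s.biUnion V) =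
        #(V a) + #(s.biUnion V) := by
      exact_mod_cast card_union_add_card_inter (V a) (s.biUnion V)
    rw [sum_insert ha, biUnion_insert, card_insert_of_notMem ha]
    push_cast
    nlinarith [mul_nonneg (Nat.cast_nonneg (α := ℝ) #s) hc]

/-- The numbers `a * (p + 1)` at most `N`, for odd primes `p`. -/
def shiftedPrimeMultiples (a N : ℕ) : Finset ℕ :=
  ((N / a).primesBelow.erase 2).image fun p => a * (p + 1)

open Finset in
theorem mem_shiftedPrimeMultiples {a N n : ℕ} (ha : 0 < a) :
    n ∈ shiftedPrimeMultiples a N ↔ n ≤ N ∧ ∃ p, p.Prime ∧ p ≠ 2 ∧ a * (p + 1) = n := by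
  simp only [shiftedPrimeMultiples, mem_image, mem_erase, Nat.mem_primesBelow]
  constructor
  · rintro ⟨p, ⟨hp2, hlt, hp⟩, rfl⟩
    refine ⟨?_, p, hp, hp2, rfl⟩
    exact (Nat.mul_le_mul_left a hlt).trans (Nat.mul_div_le N a)
  · rintro ⟨hn, p, hp, hp2, rfl⟩
    exact ⟨p, ⟨hp2, (Nat.le_div_iff_mul_le ha).mpr (by linarith), hp⟩, rfl⟩

open Finset Filter in
theorem eventually_le_card_shiftedPrimeMultiples {a : ℕ} (ha : 0 < a) :
    ∀ᶠ N : ℕ in atTop,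
      1 / (4 * a) * (N / Real.log N) ≤ (#(shiftedPrimeMultiples a N) : ℝ) := by
  have ha' : (0 : ℝ) < a := by exact_mod_cast ha
  have ho : ∀ᶠ N : ℕ in atTop, Real.log N ≤ 2 / (25 * a) * N := by
    have h := (Real.isLittleO_log_id_atTop.comp_tendsto
      (tendsto_natCast_atTop_atTop (R := ℝ))).def (show 0 < 2 / (25 * (a : ℝ)) by positivity)
    filter_upwards [h] with N hN
    simpa using (le_abs_self _).trans hN
  have hlogtop : Tendsto (fun N : ℕ => Real.log N) atTop atTop :=
    Real.tendsto_log_atTop.comp tendsto_natCast_atTop_atTop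
  filter_upwards [ho, hlogtop.eventually_ge_atTop 1, eventually_ge_atTop a,
    eventually_gt_atTop 0] with N hN hy haN hN0
  set y := Real.log N with hyd
  set k := N / a with hk
  have hk1 : 1 ≤ k := (Nat.one_le_div_iff ha).mpr haN
  have hk1' : (1 : ℝ) ≤ k := by exact_mod_cast hk1
  have hkN : (k : ℝ) ≤ N := by exact_mod_cast Nat.div_le_self N a
  have hkge : (N : ℝ) / a ≤ k + 1 := by
    rw [div_le_iff₀ ha']
    have := Nat.lt_mul_div_succ N ha
    rw [← hk] at this
    have : (N : ℝ) < a * (k + 1) := by exact_mod_cast this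
    linarith
  have hcardV : Nat.primeCounting k ≤ #(shiftedPrimeMultiples a N) + 2 := by
    have h1 : #(shiftedPrimeMultiples a N) = #(k.primesBelow.erase 2) :=
      card_image_of_injective _ fun p q h => by
        have := Nat.eq_of_mul_eq_mul_left ha h
        omega
    have h2 : #k.primesBelow - 1 ≤ #(k.primesBelow.erase 2) := pred_card_le_card_erase
    have h3 : Nat.primeCounting k ≤ #k.primesBelow + 1 := by
      rw [Nat.primesBelow_card_eq_primeCounting', Nat.primeCounting, Nat.primeCounting',
        Nat.count_succ]
      split_ifs <;> omega
    omega
  have hcardV' : (Nat.primeCounting k : ℝ) ≤ #(shiftedPrimeMultiples a N) + 2 := by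
    exact_mod_cast hcardV
  have hpsi : (k : ℝ) * Real.log 2 - Real.log (k + 1) ≤ Nat.primeCounting k * Real.log k :=
    (Chebyshev.psi_ge k).trans (Chebyshev.psi_le_primeCounting_mul_log k)
  have hlogk : Real.log k ≤ y := Real.log_le_log (by linarith) hkN
  have hlogk1 : Real.log (k + 1) ≤ Real.log 2 + y := by
    rw [hyd, ← Real.log_mul (by norm_num) (by positivity)]
    exact Real.log_le_log (by linarith) (by linarith)
  have hpi : Nat.primeCounting k * Real.log k ≤ (#(shiftedPrimeMultiples a N) + 2) * y := by
    gcongr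
  have hl1 := Real.log_two_gt_d9
  have hl2 := Real.log_two_lt_d9
  have hk2 : ((N : ℝ) / a - 1) * (0.69 : ℝ) ≤ k * Real.log 2 := by
    have h1 : ((N : ℝ) / a - 1) * (0.69 : ℝ) ≤ k * 0.69 := by gcongr; linarith
    exact h1.trans (mul_le_mul_of_nonneg_left (by linarith) (by linarith))
  have hN' : y ≤ 0.08 * (N / a) := by
    calc y ≤ 2 / (25 * a) * N := hN
      _ = 0.08 * (N / a) := by field_simp; norm_num
  have hfin : (N : ℝ) / a / 4 ≤ #(shiftedPrimeMultiples a N) * y := by linarith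
  calc 1 / (4 * a) * (N / y) = (N : ℝ) / a / 4 / y := by field_simp
    _ ≤ _ := (div_le_iff₀ (by linarith)).mpr hfin

open Finset in
theorem card_shiftedPrimeMultiples_inter_le {a b : ℕ} (ha : 0 < a) (hb : 0 < b) (N : ℕ) :
    #(shiftedPrimeMultiples a N ∩ shiftedPrimeMultiples b N) ≤
      #{t ∈ Ioc 0 N | (a.lcm b / a * t - 1).Prime ∧ (a.lcm b / b * t - 1).Prime} := by
  have hl : 0 < a.lcm b := Nat.lcm_pos ha hb
  have hA : a * (a.lcm b / a) = a.lcm b := Nat.mul_div_cancel' (Nat.dvd_lcm_left a b)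
  have hB : b * (a.lcm b / b) = a.lcm b := Nat.mul_div_cancel' (Nat.dvd_lcm_right a b)
  refine (card_le_card fun n hn => ?_).trans
    (card_image_le (f := fun t => a.lcm b * t))
  rw [mem_inter, mem_shiftedPrimeMultiples ha, mem_shiftedPrimeMultiples hb] at hn
  obtain ⟨⟨hnN, p, hp, -, hpn⟩, -, q, hq, -, hqn⟩ := hn
  obtain ⟨t, ht⟩ := Nat.lcm_dvd (Dvd.intro _ hpn) (Dvd.intro _ hqn)
  have ht0 : 0 < t := by
    rcases Nat.eq_zero_or_pos t with rfl | h
    · have : 0 < a * (p + 1) := by positivity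
      omega
    · exact h
  have hp' : a.lcm b / a * t = p + 1 := Nat.eq_of_mul_eq_mul_left ha (by
    rw [← mul_assoc, hA, ← ht, hpn])
  have hq' : a.lcm b / b * t = q + 1 := Nat.eq_of_mul_eq_mul_left hb (by
    rw [← mul_assoc, hB, ← ht, hqn])
  refine mem_image.mpr ⟨t, mem_filter.mpr ⟨mem_Ioc.mpr ⟨ht0, ?_⟩, ?_, ?_⟩, ht.symm⟩
  · exact (Nat.le_mul_of_pos_left t hl).trans (ht ▸ hnN)
  · rwa [hp', Nat.add_sub_cancel]
  · rwa [hq', Nat.add_sub_cancel]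

open Finset Filter in
theorem eventually_card_shiftedPrimeMultiples_inter_le {a b : ℕ} (ha : 0 < a) (hb : 0 < b)
    (hab : a ≠ b) {η : ℝ} (hη : 0 < η) :
    ∀ᶠ N : ℕ in atTop,
      (#(shiftedPrimeMultiples a N ∩ shiftedPrimeMultiples b N) : ℝ) ≤
        η * (N / Real.log N) := by
  have hl : 0 < a.lcm b := Nat.lcm_pos ha hb
  have hA : a * (a.lcm b / a) = a.lcm b := Nat.mul_div_cancel' (Nat.dvd_lcm_left a b)
  have hB : b * (a.lcm b / b) = a.lcm b := Nat.mul_div_cancel' (Nat.dvd_lcm_right a b)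
  have hA0 : 0 < a.lcm b / a := Nat.div_pos (Nat.le_of_dvd hl (Nat.dvd_lcm_left a b)) ha
  have hB0 : 0 < a.lcm b / b := Nat.div_pos (Nat.le_of_dvd hl (Nat.dvd_lcm_right a b)) hb
  have hne : a.lcm b / a ≠ a.lcm b / b := fun h =>
    hab (Nat.eq_of_mul_eq_mul_right hA0 (by rw [hA]; rw [h, hB]))
  filter_upwards [eventually_card_prime_pairs_le hA0 hB0 hne hη] with N hN
  exact le_trans (by exact_mod_cast card_shiftedPrimeMultiples_inter_le ha hb N) hN

open Finset Filter in
theorem exists_odd_primes_le_sum :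
    ∃ Q : Finset ℕ, (∀ q ∈ Q, q.Prime ∧ q ≠ 2) ∧
      3 ≤ ∑ q ∈ Q, 1 / (4 * ((4 * (q + 1) : ℕ) : ℝ)) := by
  have htop : Tendsto (fun n : ℕ => Real.log (Real.log n)) atTop atTop :=
    Real.tendsto_log_atTop.comp (Real.tendsto_log_atTop.comp tendsto_natCast_atTop_atTop)
  obtain ⟨n, hn, hn3⟩ := ((htop.eventually_ge_atTop 98).and (eventually_ge_atTop 3)).exists
  refine ⟨n.primesBelow.erase 2, fun q hq => ?_, ?_⟩
  · rw [mem_erase] at hq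
    exact ⟨Nat.prime_of_mem_primesBelow hq.2, hq.1⟩
  · have hsum := log_log_le_sum_primesBelow n (by omega)
    have h2 : 2 ∈ n.primesBelow := Nat.mem_primesBelow.mpr ⟨by omega, Nat.prime_two⟩
    rw [← add_sum_erase _ _ h2] at hsum
    have hle : ∑ q ∈ n.primesBelow.erase 2, 1 / 32 * (1 / (q : ℝ)) ≤
        ∑ q ∈ n.primesBelow.erase 2, 1 / (4 * ((4 * (q + 1) : ℕ) : ℝ)) := by
      refine sum_le_sum fun q hq => ?_
      have hq1 := (Nat.prime_of_mem_primesBelow (mem_erase.mp hq).2).pos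
      have hq1' : (1 : ℝ) ≤ q := by exact_mod_cast hq1
      rw [one_div_mul_one_div]
      refine one_div_le_one_div_of_le (by positivity) ?_
      push_cast
      linarith
    rw [← mul_sum] at hle
    norm_num at hsum
    norm_num at hle ⊢
    linarith

open Finset Filter in
theorem eventually_exists_hadamardOrder_finset :
    ∀ᶠ N : ℕ in atTop, ∃ U : Finset ℕ, (∀ n ∈ U, 0 < n ∧ n ≤ N ∧ HadamardOrder n) ∧
      2 * (N / Real.log N) ≤ (#U : ℝ) := by
  obtain ⟨Q, hQ, hsum⟩ := exists_odd_primes_le_sum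
  set η : ℝ := 1 / ((#Q : ℝ) ^ 2 + 1) with hη
  have hη0 : 0 < η := by positivity
  have hlow : ∀ᶠ N : ℕ in atTop, ∀ q ∈ Q, 1 / (4 * ((4 * (q + 1) : ℕ) : ℝ)) *
      (N / Real.log N) ≤ (#(shiftedPrimeMultiples (4 * (q + 1)) N) : ℝ) :=
    (eventually_all_finset Q).mpr fun q _ =>
      eventually_le_card_shiftedPrimeMultiples (by positivity)
  have hinter : ∀ᶠ N : ℕ in atTop, ∀ q ∈ Q, ∀ r ∈ Q, q ≠ r →
      (#(shiftedPrimeMultiples (4 * (q + 1)) N ∩ shiftedPrimeMultiples (4 * (r + 1)) N) : ℝ) ≤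
        η * (N / Real.log N) :=
    (eventually_all_finset Q).mpr fun q _ => (eventually_all_finset Q).mpr fun r _ =>
      eventually_imp_distrib_left.mpr fun hqr =>
        eventually_card_shiftedPrimeMultiples_inter_le (by positivity) (by positivity)
          (by omega) hη0
  filter_upwards [hlow, hinter] with N h1 h2
  set X : ℝ := N / Real.log N with hX
  have hX0 : 0 ≤ X := div_nonneg N.cast_nonneg (Real.log_natCast_nonneg N)
  refine ⟨Q.biUnion fun q => shiftedPrimeMultiples (4 * (q + 1)) N, fun n hn => ?_, ?_⟩
  · obtain ⟨q, hq, hn⟩ := mem_biUnion.mp hn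
    obtain ⟨hnN, p, hp, hp2, rfl⟩ := (mem_shiftedPrimeMultiples (by positivity)).mp hn
    refine ⟨by positivity, hnN, ?_⟩
    have h := (hadamardOrder_two_mul_prime_add_one (hQ q hq).1 (hQ q hq).2).mul
      (hadamardOrder_two_mul_prime_add_one hp hp2)
    rwa [show 2 * (q + 1) * (2 * (p + 1)) = 4 * (q + 1) * (p + 1) by ring] at h
  · have hbon := sum_card_le_card_biUnion_add Q
      (fun q => shiftedPrimeMultiples (4 * (q + 1)) N) h2 (by positivity)
    have hs := sum_le_sum h1
    rw [← sum_mul] at hs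
    have h3 : 3 * X ≤ _ := mul_le_mul_of_nonneg_right hsum hX0
    have hηQ : (#Q : ℝ) ^ 2 * η ≤ 1 := by
      rw [hη, mul_one_div, div_le_one (by positivity)]
      linarith
    have h4 : (#Q : ℝ) ^ 2 * (η * X) ≤ X := by
      rw [← mul_assoc]
      exact mul_le_of_le_one_left hX0 hηQ
    linarith

theorem card_le_S {x : ℝ} {N : ℕ} (hNx : (N : ℝ) ≤ x) (U : Finset ℕ)
    (hU : ∀ n ∈ U, 0 < n ∧ n ≤ N ∧ HadamardOrder n) : U.card ≤ S x := by
  rw [S, ← Set.ncard_coe_finset]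
  refine Set.ncard_le_ncard (fun n hn => ?_) ?_
  · obtain ⟨h1, h2, h3⟩ := hU n hn
    exact ⟨h1, le_trans (by exact_mod_cast h2) hNx, h3⟩
  · exact (Set.finite_Iic ⌊x⌋₊).subset fun n hn => Nat.le_floor hn.2.1

open Filter in
theorem hadamard_count_paley_doubling_lower :
    ∀ ε : ℝ, ε > 0 → ∃ x₀ : ℝ, ∀ x : ℝ, x ≥ x₀ →
      (S x : ℝ) ≥ (3 / 2 - ε) * x / Real.log x := by
  intro ε hε
  have h := (tendsto_nat_floor_atTop (α := ℝ)).eventually eventually_exists_hadamardOrder_finset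
  obtain ⟨x₀, hx₀⟩ := eventually_atTop.mp (h.and (eventually_ge_atTop (4 : ℝ)))
  refine ⟨x₀, fun x hx => ?_⟩
  obtain ⟨⟨U, hU, hcard⟩, hx4⟩ := hx₀ x hx
  have hfloor : (⌊x⌋₊ : ℝ) ≤ x := Nat.floor_le (by linarith)
  have hlt : x < ⌊x⌋₊ + 1 := Nat.lt_floor_add_one x
  have hlogN : 0 < Real.log (⌊x⌋₊ : ℝ) := Real.log_pos (by linarith)
  have hlog : Real.log (⌊x⌋₊ : ℝ) ≤ Real.log x := Real.log_le_log (by linarith) hfloor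
  have hS : (U.card : ℝ) ≤ S x := by exact_mod_cast card_le_S hfloor U hU
  calc (3 / 2 - ε) * x / Real.log x ≤ 2 * ⌊x⌋₊ / Real.log x := by
        refine div_le_div_of_nonneg_right ?_ (hlogN.le.trans hlog)
        nlinarith
    _ ≤ 2 * ⌊x⌋₊ / Real.log (⌊x⌋₊ : ℝ) := by gcongr
    _ = 2 * (⌊x⌋₊ / Real.log (⌊x⌋₊ : ℝ)) := mul_div_assoc _ _ _
    _ ≤ U.card := hcard
    _ ≤ S x := hS
end

section
/- If a, b, c, d are positive integers such that Hadamard matrices of orders 4a, 4b, 4c and 4d all exist, then there exists a Hadamard matrix of order 16abcd. -/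
open Matrix
open scoped Kronecker

/-- A pair of `{-1, +1}` matrices `S`, `R` with `S * Rᵀ = 0` and `S * Sᵀ + R * Rᵀ = t • 1`. -/
structure IsOrthogonalPair {m n : Type*} [DecidableEq m] [Fintype n]
    (t : ℝ) (S R : Matrix m n ℝ) : Prop where
  left_entry : ∀ i j, S i j = 1 ∨ S i j = -1
  right_entry : ∀ i j, R i j = 1 ∨ R i j = -1
  mul_transpose_eq_zero : S * Rᵀ = 0
  add_eq : S * Sᵀ + R * Rᵀ = t • (1 : Matrix m m ℝ)

/-- The `p`-th of the four row strips of a matrix of order `4 * b`. -/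
def rowStrip {b : ℕ} (K : Matrix (Fin (4 * b)) (Fin (4 * b)) ℝ) (p : Fin 4) :
    Matrix (Fin b) (Fin (4 * b)) ℝ :=
  K.submatrix (fun j => finProdFinEquiv (p, j)) id

/-- The `p`-th of the four column strips of a matrix of order `4 * a`. -/
def colStrip {a : ℕ} (H : Matrix (Fin (4 * a)) (Fin (4 * a)) ℝ) (p : Fin 4) :
    Matrix (Fin (4 * a)) (Fin a) ℝ :=
  H.submatrix id (fun j => finProdFinEquiv (p, j))

theorem IsHadamardMatrix.rowStrip_mul_transpose {b : ℕ}
    {K : Matrix (Fin (4 * b)) (Fin (4 * b)) ℝ} (hK : IsHadamardMatrix K) (p q : Fin 4) :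
    rowStrip K p * (rowStrip K q)ᵀ = if p = q then (4 * b : ℝ) • 1 else 0 := by
  ext i j
  have h := congrFun (congrFun hK.2 (finProdFinEquiv (p, i))) (finProdFinEquiv (q, j))
  have h' : (rowStrip K p * (rowStrip K q)ᵀ) i j =
      (K * Kᵀ) (finProdFinEquiv (p, i)) (finProdFinEquiv (q, j)) := rfl
  rw [h', h, Matrix.smul_apply, Matrix.one_apply]
  simp only [finProdFinEquiv.apply_eq_iff_eq, Prod.mk.injEq]
  by_cases hpq : p = q <;> simp [Matrix.one_apply, hpq]

theorem IsHadamardMatrix.sum_colStrip_mul_transpose {a : ℕ}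
    {H : Matrix (Fin (4 * a)) (Fin (4 * a)) ℝ} (hH : IsHadamardMatrix H) :
    ∑ p, colStrip H p * (colStrip H p)ᵀ = (4 * a : ℝ) • 1 := by
  have h := hH.2
  push_cast at h
  rw [← h]
  ext i j
  simp only [Matrix.sum_apply, Matrix.mul_apply, Matrix.transpose_apply]
  rw [← finProdFinEquiv.sum_comp, Fintype.sum_prod_type]
  rfl

/-- The combination `(U₁ + U₂) / 2 ⊗ V₁ + (U₁ - U₂) / 2 ⊗ V₂`. -/
noncomputable def interleave {k l m n : Type*} (U₁ U₂ : Matrix k l ℝ) (V₁ V₂ : Matrix m n ℝ) :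
    Matrix (k × m) (l × n) ℝ :=
  ((1 / 2 : ℝ) • (U₁ + U₂)) ⊗ₖ V₁ + ((1 / 2 : ℝ) • (U₁ - U₂)) ⊗ₖ V₂

section interleave

variable {k l m n : Type*}

theorem interleave_entry {U₁ U₂ : Matrix k l ℝ} {V₁ V₂ : Matrix m n ℝ}
    (hU₁ : ∀ i j, U₁ i j = 1 ∨ U₁ i j = -1) (hU₂ : ∀ i j, U₂ i j = 1 ∨ U₂ i j = -1)
    (hV₁ : ∀ i j, V₁ i j = 1 ∨ V₁ i j = -1) (hV₂ : ∀ i j, V₂ i j = 1 ∨ V₂ i j = -1)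
    (i : k × m) (j : l × n) :
    interleave U₁ U₂ V₁ V₂ i j = 1 ∨ interleave U₁ U₂ V₁ V₂ i j = -1 := by
  simp only [interleave, Matrix.add_apply, Matrix.sub_apply, Matrix.smul_apply,
    Matrix.kroneckerMap_apply, smul_eq_mul]
  rcases hU₁ i.1 j.1 with h | h <;> rcases hU₂ i.1 j.1 with h' | h' <;>
    rcases hV₁ i.2 j.2 with g | g <;> rcases hV₂ i.2 j.2 with g' | g' <;>
    norm_num [h, h', g, g']

variable [Fintype l] [Fintype n]

theorem interleave_mul_transpose (U₁ U₂ U₃ U₄ : Matrix k l ℝ) (V₁ V₂ V₃ V₄ : Matrix m n ℝ) :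
    interleave U₁ U₂ V₁ V₂ * (interleave U₃ U₄ V₃ V₄)ᵀ =
      ((1 / 4 : ℝ) • ((U₁ + U₂) * (U₃ + U₄)ᵀ)) ⊗ₖ (V₁ * V₃ᵀ) +
      ((1 / 4 : ℝ) • ((U₁ + U₂) * (U₃ - U₄)ᵀ)) ⊗ₖ (V₁ * V₄ᵀ) +
      ((1 / 4 : ℝ) • ((U₁ - U₂) * (U₃ + U₄)ᵀ)) ⊗ₖ (V₂ * V₃ᵀ) +
      ((1 / 4 : ℝ) • ((U₁ - U₂) * (U₃ - U₄)ᵀ)) ⊗ₖ (V₂ * V₄ᵀ) := by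
  have h (x y : Matrix k l ℝ) :
      ((1 / 2 : ℝ) • x) * ((1 / 2 : ℝ) • y)ᵀ = (1 / 4 : ℝ) • (x * yᵀ) := by
    rw [Matrix.transpose_smul, Matrix.smul_mul, Matrix.mul_smul, smul_smul]
    norm_num
  simp only [interleave, Matrix.transpose_add (_ ⊗ₖ _), Matrix.add_mul (_ ⊗ₖ _),
    Matrix.mul_add (_ ⊗ₖ _), ← Matrix.kroneckerMap_transpose, ← Matrix.mul_kronecker_mul, h]
  abel

theorem interleave_mul_transpose_self [DecidableEq m] {U₁ U₂ : Matrix k l ℝ}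
    {V₁ V₂ : Matrix m n ℝ} {s : ℝ} (h₁ : V₁ * V₁ᵀ = s • 1) (h₂ : V₂ * V₂ᵀ = s • 1)
    (h₁₂ : V₁ * V₂ᵀ = 0) (h₂₁ : V₂ * V₁ᵀ = 0) :
    interleave U₁ U₂ V₁ V₂ * (interleave U₁ U₂ V₁ V₂)ᵀ =
      (s / 2) • ((U₁ * U₁ᵀ + U₂ * U₂ᵀ) ⊗ₖ (1 : Matrix m m ℝ)) := by
  rw [interleave_mul_transpose, h₁, h₂, h₁₂, h₂₁, Matrix.kronecker_zero, Matrix.kronecker_zero,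
    add_zero, add_zero, ← Matrix.add_kronecker, Matrix.kronecker_smul, ← smul_add]
  have h : (U₁ + U₂) * (U₁ + U₂)ᵀ + (U₁ - U₂) * (U₁ - U₂)ᵀ =
      (2 : ℝ) • (U₁ * U₁ᵀ + U₂ * U₂ᵀ) := by
    simp only [Matrix.transpose_add, Matrix.transpose_sub, Matrix.add_mul, Matrix.mul_add,
      Matrix.sub_mul, Matrix.mul_sub, two_smul]
    abel
  rw [h, Matrix.smul_kronecker, Matrix.smul_kronecker, smul_smul, smul_smul]
  congr 1
  ring

end interleave

/-- Interleaving column strips of one Hadamard matrix with row strips of another. -/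
theorem HadamardOrder.exists_isOrthogonalPair {a b : ℕ}
    (hA : HadamardOrder (4 * a)) (hB : HadamardOrder (4 * b)) :
    ∃ S R : Matrix (Fin (4 * a) × Fin b) (Fin a × Fin (4 * b)) ℝ,
      IsOrthogonalPair (8 * a * b) S R := by
  obtain ⟨H, hH⟩ := hA
  obtain ⟨K, hK⟩ := hB
  have hmul := hK.rowStrip_mul_transpose
  have hsum := hH.sum_colStrip_mul_transpose
  have hself (p q : Fin 4) (hpq : p ≠ q) := interleave_mul_transpose_self
    (U₁ := colStrip H p) (U₂ := colStrip H q)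
    ((hmul p p).trans (if_pos rfl)) ((hmul q q).trans (if_pos rfl))
    ((hmul p q).trans (if_neg hpq)) ((hmul q p).trans (if_neg hpq.symm))
  refine ⟨interleave (colStrip H 0) (colStrip H 1) (rowStrip K 0) (rowStrip K 1),
    interleave (colStrip H 2) (colStrip H 3) (rowStrip K 2) (rowStrip K 3), ?_, ?_, ?_, ?_⟩
  · exact interleave_entry (fun _ _ => hH.1 _ _) (fun _ _ => hH.1 _ _)
      (fun _ _ => hK.1 _ _) (fun _ _ => hK.1 _ _)
  · exact interleave_entry (fun _ _ => hH.1 _ _) (fun _ _ => hH.1 _ _)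
      (fun _ _ => hK.1 _ _) (fun _ _ => hK.1 _ _)
  · simp [interleave_mul_transpose, hmul]
  · rw [Fin.sum_univ_four, add_assoc] at hsum
    rw [hself 0 1 (by decide), hself 2 3 (by decide), ← smul_add, ← Matrix.add_kronecker, hsum,
      Matrix.smul_kronecker, Matrix.one_kronecker_one, smul_smul]
    congr 1
    ring

section OrthogonalPair

variable {m n m' n' : Type*} [DecidableEq m] [Fintype n] [DecidableEq m'] [Fintype n']
  {t t' : ℝ} {S R : Matrix m n ℝ} {S' R' : Matrix m' n' ℝ}

theorem IsOrthogonalPair.mul_transpose_eq_zero_symm (h : IsOrthogonalPair t S R) : R * Sᵀ = 0 := by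
  simpa using congrArg Matrix.transpose h.mul_transpose_eq_zero

theorem IsOrthogonalPair.interleave_mul_transpose (h : IsOrthogonalPair t S R)
    (h' : IsOrthogonalPair t' S' R') :
    interleave S' R' S R * (interleave S' R' S R)ᵀ = (t * t' / 4) • 1 := by
  have hp : (S' + R') * (S' + R')ᵀ = t' • 1 := by
    rw [← h'.add_eq]
    simp [Matrix.add_mul, Matrix.mul_add, h'.mul_transpose_eq_zero, h'.mul_transpose_eq_zero_symm]
  have hm : (S' - R') * (S' - R')ᵀ = t' • 1 := by
    rw [← h'.add_eq]
    simp [Matrix.sub_mul, Matrix.mul_sub, h'.mul_transpose_eq_zero, h'.mul_transpose_eq_zero_symm]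
  rw [_root_.interleave_mul_transpose, hp, hm, h.mul_transpose_eq_zero, h.mul_transpose_eq_zero_symm,
    Matrix.kronecker_zero, Matrix.kronecker_zero, add_zero, add_zero, ← Matrix.kronecker_add,
    h.add_eq, smul_smul, Matrix.smul_kronecker, Matrix.kronecker_smul, Matrix.one_kronecker_one,
    smul_smul]
  congr 1
  ring

end OrthogonalPair

theorem HadamardOrder.of_card_eq {m n : Type*} [Fintype m] [DecidableEq m] [Fintype n] {N : ℕ}
    (hm : Fintype.card m = N) (hn : Fintype.card n = N) {M : Matrix m n ℝ}
    (hM : ∀ i j, M i j = 1 ∨ M i j = -1) (hmul : M * Mᵀ = (N : ℝ) • 1) : HadamardOrder N := by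
  refine ⟨Matrix.reindex (Fintype.equivFinOfCardEq hm) (Fintype.equivFinOfCardEq hn) M,
    fun _ _ => hM _ _, ?_⟩
  rw [Matrix.transpose_reindex, Matrix.reindex_apply, Matrix.reindex_apply,
    Matrix.submatrix_mul_equiv, hmul, Matrix.submatrix_smul, Pi.smul_apply, Pi.smul_apply,
    Matrix.submatrix_one_equiv]

theorem hadamard_product_16abcd (a b c d : ℕ) (ha : 0 < a) (hb : 0 < b)
    (hc : 0 < c) (hd : 0 < d)
    (hA : HadamardOrder (4 * a)) (hB : HadamardOrder (4 * b))
    (hC : HadamardOrder (4 * c)) (hD : HadamardOrder (4 * d)) :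
    HadamardOrder (16 * (a * b * c * d)) := by
  obtain ⟨S, R, h⟩ := hA.exists_isOrthogonalPair hB
  obtain ⟨S', R', h'⟩ := hC.exists_isOrthogonalPair hD
  refine HadamardOrder.of_card_eq ?_ ?_
    (interleave_entry h'.left_entry h'.right_entry h.left_entry h.right_entry) ?_
  · simp only [Fintype.card_prod, Fintype.card_fin]
    ring
  · simp only [Fintype.card_prod, Fintype.card_fin]
    ring
  · rw [h.interleave_mul_transpose h']
    congr 1
    push_cast
    ring
end
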